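/- Let θ₀ ∈ (0,2π) with θ₀ ∉ πℚ, let C = {re^{iθ} : r > 0, θ ∈ (0,θ₀)}, let c₀ ≠ 0, let m ≥ 1, and let H(re^{iθ}) = a r^m e^{imθ} + b r^m e^{−imθ} be a harmonic homogeneous polynomial of degree m on ℝ². Suppose w solves Δw = 0 in C, w = 0 on {θ = 0} and on {θ = θ₀}, and the Bernoulli conditions ∂_θ w(re^{iθ})|_{θ=0} = c₀ ∂_θ H(re^{iθ})|_{θ=0} and ∂_θ w(re^{iθ})|_{θ=θ₀} = c₀ ∂_θ H(re^{iθ})|_{θ=θ₀} for all r > 0. Then a = b = 0, hence w ≡ 0 and H ≡ 0. -/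

import Mathlib

open Set

noncomputable section

/-- the open planar sector of opening angle `θ₀`, viewed in `ℂ` -/
def CSec (θ₀ : ℝ) : Set ℂ :=
  {z : ℂ | ∃ r θ : ℝ, 0 < r ∧ 0 < θ ∧ θ < θ₀ ∧ z = (r : ℂ) * Complex.exp (θ * Complex.I)}

/-- pointwise Laplacian of a function on `ℂ ≅ ℝ²` -/
def lapC (w : ℂ → ℂ) (z : ℂ) : ℂ :=
  fderiv ℝ (fun y => fderiv ℝ w y 1) z 1
    + fderiv ℝ (fun y => fderiv ℝ w y Complex.I) z Complex.I

section Auxiliary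

open Metric Filter Topology InnerProductSpace

theorem HasDerivAt.nonpos_of_eventually_le {f : ℝ → ℝ} {f' a : ℝ} (hf : HasDerivAt f f' a)
    (h : ∀ᶠ x in 𝓝[>] a, f x ≤ f a) : f' ≤ 0 := by
  have h1 : Tendsto (slope f a) (𝓝[>] a) (𝓝 f') :=
    (hasDerivAt_iff_tendsto_slope.1 hf).mono_left
      (nhdsWithin_mono a fun x hx => ne_of_gt hx)
  refine le_of_tendsto h1 ?_
  filter_upwards [h, self_mem_nhdsWithin] with x hx hxa
  rw [slope_def_field]
  exact div_nonpos_of_nonpos_of_nonneg (by linarith) (by linarith [mem_Ioi.1 hxa])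

/-- Adding a positive multiple of `‖z - c‖ ^ 2` to a harmonic function destroys all local maxima. -/
theorem not_isLocalMax_harmonic_add_sq {P : ℂ → ℝ} {z₀ c : ℂ} {η : ℝ} (hη : 0 < η)
    (hP : HarmonicAt P z₀) : ¬ IsLocalMax (fun z => P z + η * Complex.normSq (z - c)) z₀ := by
  intro hmax
  set A : ℂ → ℂ := fun z => 2 * η * (starRingEnd ℂ (z₀ - c)) * (z - z₀) with hA
  have hQ : ∀ᶠ z in 𝓝 z₀, HarmonicAt (P + fun z => (A z).re) z := by
    filter_upwards [hP.eventually] with z hz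
    refine hz.add (AnalyticAt.harmonicAt_re ?_)
    fun_prop
  obtain ⟨ρ, hρ, hball⟩ := Metric.eventually_nhds_iff_ball.1 (hQ.and hmax)
  have hr : |ρ / 2| = ρ / 2 := abs_of_pos (by linarith)
  have hsub : closedBall z₀ |ρ / 2| ⊆ ball z₀ ρ := by
    rw [hr]; exact closedBall_subset_ball (by linarith)
  have hH : HarmonicOnNhd (P + fun z => (A z).re) (closedBall z₀ |ρ / 2|) :=
    fun z hz => (hball z (hsub hz)).1
  have havg := InnerProductSpace.HarmonicOnNhd.circleAverage_eq hH
  have hint : CircleIntegrable (P + fun z => (A z).re) z₀ (ρ / 2) :=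
    ContinuousOn.circleIntegrable' fun z hz =>
      (hH z (sphere_subset_closedBall hz)).1.continuousAt.continuousWithinAt
  have hle := Real.circleAverage_mono_on_of_le_circle (a := P z₀ - η * (ρ / 2) ^ 2) hint (by
    intro z hz
    have h1 := (hball z (hsub (sphere_subset_closedBall hz))).2
    rw [hr, mem_sphere, dist_eq_norm] at hz
    have h2 : Complex.normSq (z - z₀) = (ρ / 2) ^ 2 := by
      rw [Complex.normSq_eq_norm_sq, hz]
    simp only [hA, Pi.add_apply, Complex.normSq_apply, Complex.mul_re, Complex.mul_im,
      Complex.sub_re, Complex.sub_im, map_sub, Complex.conj_re, Complex.conj_im, Complex.ofReal_re,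
      Complex.ofReal_im, Complex.re_ofNat, Complex.im_ofNat] at h1 h2 ⊢
    rw [← h2]
    linarith)
  rw [havg] at hle
  simp only [Pi.add_apply, hA, sub_self, mul_zero, Complex.zero_re] at hle
  nlinarith [mul_pos hη (pow_pos hρ 2)]

/-- Maximum principle on a disc for functions harmonic off the real axis which have a
two-sided angular derivative at the points of the real axis. -/
theorem le_of_harmonic_off_real {D : ℂ → ℝ} {c : ℂ} {R B : ℝ}
    (hcont : ContinuousOn D (closedBall c R))
    (hharm : ∀ z ∈ ball c R, z.im ≠ 0 → HarmonicAt D z)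
    (harc : ∀ p : ℝ, (p : ℂ) ∈ ball c R → 0 < p ∧
      DifferentiableAt ℝ (fun θ : ℝ => D (p * Complex.exp (θ * Complex.I))) 0)
    (hB : ∀ z ∈ sphere c R, D z ≤ B) {z : ℂ} (hz : z ∈ closedBall c R) : D z ≤ B := by
  have key : ∀ η : ℝ, 0 < η → D z ≤ B + η * (|c.im| + R + R ^ 2) := by
    intro η hη
    set F : ℂ → ℝ := fun z => D z + η * |z.im| + η * Complex.normSq (z - c) with hF
    have hFc : ContinuousOn F (closedBall c R) := by
      refine (hcont.add ?_).add ?_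
      · exact (continuous_const.mul Complex.continuous_im.abs).continuousOn
      · exact (continuous_const.mul (Complex.continuous_normSq.comp
          (continuous_id.sub continuous_const))).continuousOn
    obtain ⟨z₀, hz₀, hmax⟩ := (isCompact_closedBall c R).exists_isMaxOn ⟨z, hz⟩ hFc
    have hDF : D z ≤ F z := by
      have := Complex.normSq_nonneg (z - c)
      simp only [hF]
      have := mul_nonneg hη.le (abs_nonneg z.im)
      nlinarith
    rcases (mem_closedBall.1 hz₀).lt_or_eq with hlt | heq
    · exfalso
      have hmem : ball c R ∈ 𝓝 z₀ := isOpen_ball.mem_nhds hlt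
      have hloc : IsLocalMax F z₀ := by
        filter_upwards [hmem] with y hy using hmax (ball_subset_closedBall hy)
      by_cases him : z₀.im = 0
      · obtain ⟨p, rfl⟩ : ∃ p : ℝ, (p : ℂ) = z₀ := ⟨z₀.re, by apply Complex.ext <;> simp [him]⟩
        obtain ⟨hp, hd⟩ := harc p hlt
        set g : ℝ → ℂ := fun θ => p * Complex.exp (θ * Complex.I) with hg
        have hg0 : g 0 = p := by simp [hg]
        have hgc : ContinuousAt g 0 := by
          have : Continuous g := by fun_prop
          exact this.continuousAt
        have hev : ∀ᶠ θ in 𝓝 (0 : ℝ), F (g θ) ≤ F p :=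
          hgc.eventually (p := fun y => F y ≤ F p) (by rw [hg0]; exact hloc)
        set s : ℝ → ℝ := fun θ => D (g θ) + η * Complex.normSq (g θ - c) with hs
        have hsd : DifferentiableAt ℝ s 0 := by
          refine hd.add (DifferentiableAt.const_mul ?_ _)
          have : (fun θ => Complex.normSq (g θ - c)) = fun θ : ℝ =>
            (p * Real.cos θ - c.re) ^ 2 + (p * Real.sin θ - c.im) ^ 2 := by
            ext θ
            simp [hg, Complex.normSq_apply, Complex.exp_ofReal_mul_I_re,
              Complex.exp_ofReal_mul_I_im]
            ring
          rw [this]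
          fun_prop
        have hs1 := hsd.hasDerivAt
        have hs2 : HasDerivAt (fun θ => s (-θ)) (-deriv s 0) 0 := by
          have h := HasDerivAt.scomp (h := fun θ : ℝ => -θ) (h' := -1) (g₁ := s) (g₁' := deriv s 0)
            (0 : ℝ) (by simpa using hs1) (hasDerivAt_neg 0)
          simpa [Function.comp_def] using h
        have hs3 := (hs1.add hs2).add (((Real.hasDerivAt_sin 0).const_mul (2 * η * p)))
        have hnonpos := hs3.nonpos_of_eventually_le (by
          have hneg : ∀ᶠ θ in 𝓝 (0 : ℝ), F (g (-θ)) ≤ F p := by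
            have : Tendsto (fun θ : ℝ => -θ) (𝓝 0) (𝓝 0) := by
              simpa using (continuous_neg (G := ℝ)).tendsto 0
            exact this.eventually hev
          have hpi : ∀ᶠ θ in 𝓝 (0 : ℝ), θ < Real.pi := eventually_lt_nhds Real.pi_pos
          filter_upwards [nhdsWithin_le_nhds hev, nhdsWithin_le_nhds hneg,
            nhdsWithin_le_nhds hpi, self_mem_nhdsWithin] with θ h1 h2 h3 h4
          have hsin : 0 ≤ Real.sin θ := (Real.sin_pos_of_pos_of_lt_pi h4 h3).le
          have i1 : |(g θ).im| = p * Real.sin θ := by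
            have : (g θ).im = p * Real.sin θ := by
              simp [hg, Complex.exp_ofReal_mul_I_im]
            rw [this, abs_of_nonneg (mul_nonneg hp.le hsin)]
          have i2 : |(g (-θ)).im| = p * Real.sin θ := by
            have : (g (-θ)).im = -(p * Real.sin θ) := by
              have := Complex.exp_ofReal_mul_I_im (-θ)
              simp only [hg, Complex.im_ofReal_mul, this, Real.sin_neg]
              ring
            rw [this, abs_neg, abs_of_nonneg (mul_nonneg hp.le hsin)]
          simp only [hF, i1, i2, Complex.ofReal_im, abs_zero] at h1 h2
          simp only [Pi.add_apply, hs, neg_zero, hg0, Real.sin_zero]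
          linarith)
        simp only [Real.cos_zero] at hnonpos
        nlinarith [mul_pos hη hp]
      · have hev : ∃ σ : ℝ, ∀ᶠ y in 𝓝 z₀, |y.im| = σ * y.im := by
          rcases lt_or_gt_of_ne him with h | h
          · refine ⟨-1, ?_⟩
            filter_upwards [(Complex.continuous_im.tendsto z₀).eventually (eventually_lt_nhds h)]
              with y hy
            rw [abs_of_neg hy]; ring
          · refine ⟨1, ?_⟩
            filter_upwards [(Complex.continuous_im.tendsto z₀).eventually (eventually_gt_nhds h)]
              with y hy
            rw [abs_of_pos hy]; ring
        obtain ⟨σ, hσ⟩ := hev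
        have hP : HarmonicAt (D + (η * σ) • fun y : ℂ => y.im) z₀ :=
          (hharm z₀ hlt him).add ((AnalyticAt.harmonicAt_im (f := fun y => y)
            (by fun_prop)).const_smul)
        refine not_isLocalMax_harmonic_add_sq (c := c) hη hP ?_
        refine hloc.congr ?_
        filter_upwards [hσ] with y hy
        simp only [hF, hy, Pi.add_apply, Pi.smul_apply, smul_eq_mul]
        ring
    · have h1 : F z ≤ F z₀ := hmax hz
      have h2 := hB z₀ heq
      rw [dist_eq_norm] at heq
      have h3 : Complex.normSq (z₀ - c) = R ^ 2 := by rw [Complex.normSq_eq_norm_sq, heq]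
      have h4 : |z₀.im| ≤ |c.im| + R := by
        have h5 := Complex.abs_im_le_norm (z₀ - c)
        rw [heq, Complex.sub_im] at h5
        have := abs_add_le (z₀.im - c.im) c.im
        simp only [sub_add_cancel] at this
        linarith
      have : F z₀ ≤ B + η * (|c.im| + R) + η * R ^ 2 := by
        simp only [hF, h3]
        have := mul_le_mul_of_nonneg_left h4 hη.le
        linarith
      linarith
  have hlim : Tendsto (fun η : ℝ => B + η * (|c.im| + R + R ^ 2)) (𝓝[>] 0) (𝓝 B) := by
    have : Continuous (fun η : ℝ => B + η * (|c.im| + R + R ^ 2)) := by fun_prop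
    have h := (this.tendsto 0).mono_left (nhdsWithin_le_nhds (s := Ioi 0))
    simpa using h
  exact ge_of_tendsto hlim (by filter_upwards [self_mem_nhdsWithin] with η hη using key η hη)

theorem continuous_add_mul_toCircle (c : ℂ) (r : ℝ) :
    Continuous fun x : UnitAddCircle => c + r * (AddCircle.toCircle x : ℂ) :=
  continuous_const.add (continuous_const.mul
    (continuous_subtype_val.comp AddCircle.continuous_toCircle))

theorem exists_add_mul_toCircle_eq {c y : ℂ} {R : ℝ} (hR : 0 < R) (hy : y ∈ sphere c R) :
    ∃ x : UnitAddCircle, c + R * (AddCircle.toCircle x : ℂ) = y := by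
  rw [mem_sphere, dist_eq_norm] at hy
  have hmem : (y - c) / R ∈ Submonoid.unitSphere ℂ := by
    refine mem_sphere_zero_iff_norm.2 ?_
    rw [norm_div, hy, Complex.norm_real, Real.norm_of_nonneg hR.le, div_self hR.ne']
  obtain ⟨x, hx⟩ := (AddCircle.homeomorphCircle (T := 1) one_ne_zero).surjective ⟨_, hmem⟩
  refine ⟨x, ?_⟩
  rw [AddCircle.homeomorphCircle_apply] at hx
  have hRC : (R : ℂ) ≠ 0 := by exact_mod_cast hR.ne'
  rw [hx]
  change c + R * ((y - c) / R) = y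
  field_simp
  ring

theorem norm_fourierCoeff_le {f : UnitAddCircle → ℂ} {B : ℝ} (h : ∀ x, ‖f x‖ ≤ B) (n : ℤ) :
    ‖fourierCoeff f n‖ ≤ B := by
  refine (MeasureTheory.norm_integral_le_of_norm_le_const (C := B) (.of_forall fun x => ?_)).trans ?_
  · rw [norm_smul, fourier_apply, Circle.norm_coe, one_mul]
    exact h x
  · simp

/-- A trigonometric polynomial on the circle of centre `c` and radius `R` extends to a harmonic
function on the plane whose Fourier coefficients on concentric circles scale as powers of the
radius. -/
theorem exists_harmonic_extension (c : ℂ) {R : ℝ} (hR : 0 < R) {g : C(UnitAddCircle, ℂ)}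
    (hg : g ∈ Submodule.span ℂ (range (@fourier (1 : ℝ)))) :
    ∃ G : ℂ → ℂ, (∀ z, HarmonicAt G z) ∧
      (∀ x : UnitAddCircle, G (c + R * (AddCircle.toCircle x : ℂ)) = g x) ∧
      ∀ (r : ℝ) (n : ℤ), fourierCoeff (fun x : UnitAddCircle =>
        G (c + r * (AddCircle.toCircle x : ℂ))) n = ((r / R : ℝ) : ℂ) ^ n.natAbs *
          fourierCoeff g n := by
  induction hg using Submodule.span_induction with
  | mem g hg =>
    obtain ⟨k, rfl⟩ := hg
    obtain ⟨G, hG, hGr⟩ : ∃ G : ℂ → ℂ, (∀ z, HarmonicAt G z) ∧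
        ∀ (r : ℝ) (x : UnitAddCircle), G (c + r * (AddCircle.toCircle x : ℂ)) =
          ((r / R : ℝ) : ℂ) ^ k.natAbs * fourier k x := by
      have hP : ∀ z, AnalyticAt ℂ (fun z : ℂ => ((z - c) / R) ^ k.natAbs) z := by
        intro z
        have : Differentiable ℂ (fun z : ℂ => ((z - c) / R) ^ k.natAbs) := by fun_prop
        exact this.analyticAt z
      rcases Int.natAbs_eq k with hk | hk
      · refine ⟨_, fun z => (hP z).harmonicAt, fun r x => ?_⟩
        rw [fourier_apply, AddCircle.toCircle_zsmul]
        nth_rw 3 [hk]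
        rw [zpow_natCast, Circle.coe_pow, ← mul_pow]
        congr 1
        push_cast
        ring
      · refine ⟨_, fun z => (hP z).harmonicAt_conj, fun r x => ?_⟩
        nth_rw 3 [hk]
        rw [fourier_neg, fourier_apply, AddCircle.toCircle_zsmul, zpow_natCast, Circle.coe_pow,
          map_pow, ← mul_pow]
        simp only [Pi.conj_apply, map_pow]
        congr 1
        simp
        ring
    refine ⟨G, hG, fun x => ?_, fun r n => ?_⟩
    · rw [hGr, div_self hR.ne']
      simp
    · simp_rw [hGr, fourierCoeff.const_mul]
      rw [fourierCoeff_fourier]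
      by_cases h : n = k
      · subst h; rfl
      · simp [h]
  | zero => exact ⟨0, fun z => AnalyticAt.harmonicAt analyticAt_const, by simp, by simp [fourierCoeff]⟩
  | add f g _ _ hf hg =>
    obtain ⟨F, hF, hF1, hF2⟩ := hf
    obtain ⟨G, hG, hG1, hG2⟩ := hg
    refine ⟨F + G, fun z => (hF z).add (hG z), fun x => by simp [hF1, hG1], fun r n => ?_⟩
    have hint : ∀ {u : UnitAddCircle → ℂ}, Continuous u →
        MeasureTheory.Integrable u AddCircle.haarAddCircle := fun hu =>
      hu.integrable_of_hasCompactSupport (HasCompactSupport.of_compactSpace _)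
    have hc : ∀ {K : ℂ → ℂ}, (∀ z, HarmonicAt K z) → MeasureTheory.Integrable
        (fun x : UnitAddCircle => K (c + r * (AddCircle.toCircle x : ℂ))) AddCircle.haarAddCircle :=
      fun {K} hK => hint (Continuous.comp (g := K) (continuous_iff_continuousAt.2 fun z =>
        (hK z).1.continuousAt) (continuous_add_mul_toCircle c r))
    have e1 := congrFun (fourierCoeff.add (hc hF) (hc hG)) n
    have e2 := congrFun (fourierCoeff.add (hint f.continuous) (hint g.continuous)) n
    rw [ContinuousMap.coe_add, e2, Pi.add_apply, mul_add, ← hF2, ← hG2]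
    exact e1
  | smul a f _ hf =>
    obtain ⟨F, hF, hF1, hF2⟩ := hf
    refine ⟨fun z => a * F z, fun z => ?_, fun x => by simp [hF1], fun r n => ?_⟩
    · exact (hF z).comp_CLM ((ContinuousLinearMap.mul ℂ ℂ a).restrictScalars ℝ)
    · have e1 := fourierCoeff.const_mul (T := 1)
        (fun x : UnitAddCircle => F (c + r * (AddCircle.toCircle x : ℂ))) a n
      rw [e1, hF2, ContinuousMap.coe_smul, fourierCoeff.const_smul, smul_eq_mul]
      ring

/-- Local unique continuation across the real axis: a function on a disc centred below the axis
which vanishes below the axis, is harmonic above it, and has vanishing angular derivative on it,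
vanishes on the boundary circle. -/
theorem eq_zero_of_harmonic_above_real {V : ℂ → ℂ} {c : ℂ} {R : ℝ} (hR : 0 < R) (hc : c.im < 0)
    (hcont : ContinuousOn V (closedBall c R))
    (hzero : ∀ z, z.im ≤ 0 → V z = 0)
    (hharm : ∀ z ∈ ball c R, 0 < z.im → HarmonicAt V z)
    (harc : ∀ p : ℝ, (p : ℂ) ∈ ball c R → 0 < p ∧
      DifferentiableAt ℝ (fun θ : ℝ => V (p * Complex.exp (θ * Complex.I))) 0) :
    ∀ z ∈ sphere c R, V z = 0 := by
  have hnorm : ∀ {r : ℝ}, 0 ≤ r → ∀ x : UnitAddCircle,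
      c + r * (AddCircle.toCircle x : ℂ) ∈ sphere c r := by
    intro r hr x
    rw [mem_sphere, dist_eq_norm, add_sub_cancel_left, norm_mul, Circle.norm_coe, mul_one,
      Complex.norm_real, Real.norm_of_nonneg hr]
  have hharm' : ∀ z ∈ ball c R, z.im ≠ 0 → HarmonicAt V z := by
    intro z hz him
    rcases lt_or_gt_of_ne him with h | h
    · have : V =ᶠ[𝓝 z] fun _ => 0 := by
        filter_upwards [(Complex.continuous_im.tendsto z).eventually (eventually_lt_nhds h)]
          with y hy using hzero y hy.le
      exact (harmonicAt_congr_nhds this).2 (AnalyticAt.harmonicAt analyticAt_const)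
    · exact hharm z hz h
  let f : C(UnitAddCircle, ℂ) :=
    ⟨fun x => V (c + R * (AddCircle.toCircle x : ℂ)),
      hcont.comp_continuous (continuous_add_mul_toCircle c R) fun x => sphere_subset_closedBall (hnorm hR.le x)⟩
  obtain ⟨r, hr, hrR, hrc⟩ : ∃ r : ℝ, 0 < r ∧ r ≤ R ∧ r ≤ -c.im :=
    ⟨min R (-c.im), lt_min hR (by linarith), min_le_left _ _, min_le_right _ _⟩
  have hcoef : ∀ n : ℤ, fourierCoeff f n = 0 := by
    intro n
    have key : ∀ ε : ℝ, 0 < ε → ‖fourierCoeff f n‖ ≤ (1 + (R / r) ^ n.natAbs) * ε := by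
      intro ε hε
      have hf : f ∈ (Submodule.span ℂ (range (@fourier (1 : ℝ)))).topologicalClosure := by
        rw [span_fourier_closure_eq_top]; trivial
      obtain ⟨g, hg, hfg⟩ := Metric.mem_closure_iff.1 hf ε hε
      obtain ⟨G, hG, hGR, hGr⟩ := exists_harmonic_extension c hR hg
      have hGc : Continuous G := continuous_iff_continuousAt.2 fun z => (hG z).1.continuousAt
      have hbd : ∀ x, ‖f x - g x‖ ≤ ε := fun x => by
        rw [← dist_eq_norm]
        exact (ContinuousMap.dist_apply_le_dist x).trans hfg.le
      have hcomp : ∀ z ∈ closedBall c R, ‖V z - G z‖ ≤ ε := by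
        intro z hz
        obtain ⟨l, hl, hlz⟩ : ∃ l : ℂ, ‖l‖ = 1 ∧ (l * (V z - G z)).re = ‖V z - G z‖ := by
          by_cases h0 : V z - G z = 0
          · exact ⟨1, by simp, by simp [h0]⟩
          · refine ⟨starRingEnd ℂ (V z - G z) / ‖V z - G z‖, ?_, ?_⟩
            · rw [norm_div, RCLike.norm_conj, Complex.norm_real, norm_norm,
                div_self (norm_ne_zero_iff.2 h0)]
            · rw [div_mul_eq_mul_div, mul_comm, Complex.mul_conj, Complex.normSq_eq_norm_sq,
                ← Complex.ofReal_div, Complex.ofReal_re]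
              field_simp [norm_ne_zero_iff.2 h0]
        let L : ℂ →L[ℝ] ℝ := Complex.reCLM.comp ((ContinuousLinearMap.mul ℂ ℂ l).restrictScalars ℝ)
        have hL : ∀ y, L y = (l * y).re := fun y => rfl
        rw [← hlz, ← hL]
        refine le_of_harmonic_off_real (D := fun y => L (V y - G y)) ?_ ?_ ?_ ?_ hz
        · exact L.continuous.comp_continuousOn (hcont.sub hGc.continuousOn)
        · intro y hy him
          exact ((hharm' y hy him).sub (hG y)).comp_CLM L
        · intro p hp
          obtain ⟨h1, h2⟩ := harc p hp
          refine ⟨h1, L.differentiableAt.comp 0 (h2.sub ?_)⟩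
          have h3 : DifferentiableAt ℝ (fun θ : ℝ => (p : ℂ) * Complex.exp (θ * Complex.I)) 0 := by
            fun_prop
          exact DifferentiableAt.comp (g := G) 0 ((hG _).1.differentiableAt (by norm_num)) h3
        · intro y hy
          obtain ⟨x, rfl⟩ := exists_add_mul_toCircle_eq hR hy
          rw [hL]
          refine (Complex.re_le_norm _).trans ?_
          rw [norm_mul, hl, one_mul, hGR]
          exact hbd x
      have hsmall : ‖fourierCoeff (fun x : UnitAddCircle =>
          G (c + r * (AddCircle.toCircle x : ℂ))) n‖ ≤ ε := by
        refine norm_fourierCoeff_le (fun x => ?_) n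
        have hx := hnorm hr.le x
        have h1 := hcomp _ (sphere_subset_closedBall.trans (closedBall_subset_closedBall hrR) hx)
        rw [hzero _ ?_, zero_sub, norm_neg] at h1
        · exact h1
        · rw [mem_sphere, dist_eq_norm] at hx
          have := (le_abs_self _).trans (Complex.abs_im_le_norm
            (c + r * (AddCircle.toCircle x : ℂ) - c))
          rw [hx, Complex.sub_im] at this
          linarith
      have hgn : ‖fourierCoeff g n‖ ≤ (R / r) ^ n.natAbs * ε := by
        rw [hGr, norm_mul, norm_pow, Complex.norm_real, Real.norm_of_nonneg (by positivity)] at hsmall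
        calc ‖fourierCoeff g n‖ = (R / r) ^ n.natAbs * ((r / R) ^ n.natAbs * ‖fourierCoeff g n‖) := by
              rw [← mul_assoc, ← mul_pow]
              field_simp
              simp
          _ ≤ _ := by gcongr
      have hint : ∀ u : C(UnitAddCircle, ℂ), MeasureTheory.Integrable u AddCircle.haarAddCircle :=
        fun u => u.continuous.integrable_of_hasCompactSupport (HasCompactSupport.of_compactSpace _)
      have hadd := congrFun (fourierCoeff.add (hint (f - g)) (hint g)) n
      rw [← ContinuousMap.coe_add, sub_add_cancel] at hadd
      rw [hadd, Pi.add_apply]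
      refine (norm_add_le _ _).trans ?_
      have := norm_fourierCoeff_le (f := ⇑(f - g)) hbd n
      linarith
    have hlim : Tendsto (fun ε : ℝ => (1 + (R / r) ^ n.natAbs) * ε) (𝓝[>] 0) (𝓝 0) := by
      have : Continuous (fun ε : ℝ => (1 + (R / r) ^ n.natAbs) * ε) := by fun_prop
      have h := (this.tendsto 0).mono_left (nhdsWithin_le_nhds (s := Ioi 0))
      simpa using h
    have := ge_of_tendsto hlim (by filter_upwards [self_mem_nhdsWithin] with ε hε using key ε hε)
    exact norm_le_zero_iff.1 this
  have hf0 : ∀ x, f x = 0 := by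
    intro x
    have hs : fourierCoeff f = 0 := funext hcoef
    have h := has_pointwise_sum_fourier_series_of_summable (f := f) (by rw [hs]; exact summable_zero) x
    simp only [hcoef, zero_smul] at h
    exact h.unique hasSum_zero
  intro y hy
  obtain ⟨x, rfl⟩ := exists_add_mul_toCircle_eq hR hy
  exact hf0 x

theorem CSec_eq_image_exp (θ₀ : ℝ) :
    CSec θ₀ = Complex.exp '' (Complex.im ⁻¹' Ioo 0 θ₀) := by
  ext z
  constructor
  · rintro ⟨r, θ, hr, h0, h1, rfl⟩
    refine ⟨Real.log r + θ * Complex.I, by simpa using ⟨h0, h1⟩, ?_⟩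
    rw [Complex.exp_add, ← Complex.ofReal_exp, Real.exp_log hr]
  · rintro ⟨u, ⟨h0, h1⟩, rfl⟩
    refine ⟨Real.exp u.re, u.im, Real.exp_pos _, h0, h1, ?_⟩
    rw [Complex.ofReal_exp, ← Complex.exp_add, Complex.re_add_im]

theorem isOpen_CSec (θ₀ : ℝ) : IsOpen (CSec θ₀) := by
  rw [CSec_eq_image_exp]
  exact Complex.isOpenMap_exp _ (isOpen_Ioo.preimage Complex.continuous_im)

theorem isPreconnected_CSec (θ₀ : ℝ) : IsPreconnected (CSec θ₀) := by
  rw [CSec_eq_image_exp]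
  refine IsPreconnected.image ?_ _ Complex.continuous_exp.continuousOn
  exact ((convex_Ioo 0 θ₀).linear_preimage Complex.imLm).isPreconnected

theorem exp_mem_closure_CSec {θ₀ : ℝ} (hθ₀ : 0 < θ₀) {u : ℂ} (hu : u.im ∈ Icc 0 θ₀) :
    Complex.exp u ∈ closure (CSec θ₀) := by
  rw [CSec_eq_image_exp]
  refine image_closure_subset_closure_image Complex.continuous_exp ⟨u, ?_, rfl⟩
  rw [Complex.closure_preimage_im, closure_Ioo hθ₀.ne]
  exact hu

theorem lapC_eq_laplacian {w : ℂ → ℂ} {z : ℂ} (hw : ContDiffAt ℝ 2 w z) :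
    lapC w z = Laplacian.laplacian w z := by
  have hd : DifferentiableAt ℝ (fderiv ℝ w) z :=
    (hw.fderiv_right (m := 1) (by norm_num)).differentiableAt (by norm_num)
  have h : ∀ v : ℂ, fderiv ℝ (fun y => fderiv ℝ w y v) z v = fderiv ℝ (fderiv ℝ w) z v v := by
    intro v
    rw [fderiv_clm_apply hd (differentiableAt_const v)]
    simp
  rw [lapC, h, h, laplacian_eq_iteratedFDeriv_complexPlane]
  simp [iteratedFDeriv_two_apply]

theorem hasDerivAt_harmonic_polynomial_arc (A B : ℂ) (m : ℕ) (r θ : ℝ) :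
    HasDerivAt (fun θ : ℝ => A * ((r : ℂ) * Complex.exp (θ * Complex.I)) ^ m +
        B * (starRingEnd ℂ ((r : ℂ) * Complex.exp (θ * Complex.I))) ^ m)
      (Complex.I * m * r ^ m *
        (A * Complex.exp (m * θ * Complex.I) - B * Complex.exp (-(m * θ * Complex.I)))) θ := by
  have e : (fun θ : ℝ => A * ((r : ℂ) * Complex.exp (θ * Complex.I)) ^ m +
        B * (starRingEnd ℂ ((r : ℂ) * Complex.exp (θ * Complex.I))) ^ m) =
      fun θ : ℝ => A * r ^ m * Complex.exp (m * θ * Complex.I) +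
        B * r ^ m * Complex.exp (-(m * θ * Complex.I)) := by
    ext θ
    rw [map_mul, ← Complex.exp_conj, mul_pow, mul_pow, ← Complex.exp_nat_mul,
      ← Complex.exp_nat_mul]
    simp only [map_mul, Complex.conj_ofReal, Complex.conj_I]
    ring_nf
  rw [e]
  have h1 : HasDerivAt (fun θ : ℝ => (m * θ * Complex.I : ℂ)) (m * 1 * Complex.I) θ :=
    ((Complex.ofRealCLM.hasDerivAt (x := θ)).const_mul (m : ℂ)).mul_const Complex.I
  convert! (h1.cexp.const_mul (A * r ^ m : ℂ)).add (h1.neg.cexp.const_mul (B * r ^ m : ℂ)) using 1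
  rw [Pi.neg_apply]
  ring

/-- A harmonic function on a sector with vanishing Cauchy data on the ray `θ = 0` vanishes. -/
theorem eq_zero_of_cauchy_data {θ₀ : ℝ} (hθ₀ : 0 < θ₀) {v : ℂ → ℂ}
    (hcont : ContinuousOn v (closure (CSec θ₀)))
    (hharm : ∀ z ∈ CSec θ₀, HarmonicAt v z)
    (hray : ∀ r : ℝ, 0 < r → v r = 0)
    (harc : ∀ r : ℝ, 0 < r → HasDerivWithinAt
      (fun θ : ℝ => v ((r : ℂ) * Complex.exp (θ * Complex.I))) 0 (Ici 0) 0) :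
    ∀ z ∈ CSec θ₀, v z = 0 := by
  have hnear : ∀ᶠ z in 𝓝 (1 : ℂ), 0 < z.re ∧ z.arg < θ₀ := by
    refine ((Complex.continuous_re.tendsto 1).eventually (eventually_gt_nhds (by simp))).and ?_
    refine (Complex.continuousAt_arg (by simp)).eventually (eventually_lt_nhds ?_)
    simpa using hθ₀
  obtain ⟨ρ, hρ, hball⟩ := Metric.eventually_nhds_iff_ball.1 hnear
  have hmem : ∀ z ∈ ball (1 : ℂ) ρ, 0 < z.im → z ∈ CSec θ₀ := by
    intro z hz him
    have hz0 : z ≠ 0 := by rintro rfl; simp at him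
    rw [CSec_eq_image_exp]
    refine ⟨Complex.log z, ⟨?_, ?_⟩, Complex.exp_log hz0⟩
    · rw [Complex.log_im]
      refine lt_of_le_of_ne (Complex.arg_nonneg_iff.2 him.le) fun h => ?_
      exact him.ne' (Complex.arg_eq_zero_iff.1 h.symm).2
    · rw [Complex.log_im]
      exact (hball z hz).2
  have hmem' : ∀ z ∈ ball (1 : ℂ) ρ, 0 ≤ z.im → z ∈ closure (CSec θ₀) := by
    intro z hz him
    have hz0 : z ≠ 0 := by rintro rfl; simpa using (hball 0 hz).1
    rw [← Complex.exp_log hz0]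
    refine exp_mem_closure_CSec hθ₀ ⟨?_, ?_⟩
    · rw [Complex.log_im]; exact Complex.arg_nonneg_iff.2 him
    · rw [Complex.log_im]; exact (hball z hz).2.le
  set V : ℂ → ℂ := fun z => if 0 < z.im then v z else 0 with hV
  set c : ℂ := 1 - (ρ / 4 : ℝ) * Complex.I with hc
  have hc1 : dist c 1 = ρ / 4 := by
    rw [dist_eq_norm, hc, sub_sub_cancel_left, norm_neg, norm_mul, Complex.norm_I, mul_one,
      Complex.norm_real, Real.norm_of_nonneg (by linarith)]
  have hsub : closedBall c (ρ / 2) ⊆ ball 1 ρ :=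
    closedBall_subset_ball' (by rw [hc1]; linarith)
  have hreal : ∀ z : ℂ, z ∈ ball (1 : ℂ) ρ → z.im = 0 → v z = 0 := by
    intro z hz him
    have : ((z.re : ℝ) : ℂ) = z := by apply Complex.ext <;> simp [him]
    rw [← this]
    exact hray _ (hball z hz).1
  have hVcont : ContinuousOn V (closedBall c (ρ / 2)) := by
    refine ContinuousOn.if ?_ ?_ continuousOn_const
    · rintro z ⟨hz, hz'⟩
      rw [Complex.frontier_setOfPred_lt_im] at hz'
      exact hreal z (hsub hz) hz'
    · refine hcont.mono ?_
      rintro z ⟨hz, hz'⟩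
      rw [Complex.closure_setOfPred_lt_im] at hz'
      exact hmem' z (hsub hz) hz'
  have hVarc : ∀ p : ℝ, (p : ℂ) ∈ ball (1 : ℂ) ρ → 0 < p ∧
      DifferentiableAt ℝ (fun θ : ℝ => V (p * Complex.exp (θ * Complex.I))) 0 := by
    intro p hp
    have hp0 : 0 < p := by simpa using (hball p hp).1
    have him : ∀ θ : ℝ, ((p : ℂ) * Complex.exp (θ * Complex.I)).im = p * Real.sin θ := fun θ => by
      rw [Complex.im_ofReal_mul, Complex.exp_ofReal_mul_I_im]
    have hpi : ∀ᶠ θ in 𝓝 (0 : ℝ), |θ| < Real.pi := by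
      have : Tendsto (fun θ : ℝ => |θ|) (𝓝 0) (𝓝 0) := by
        simpa using (continuous_abs (G := ℝ)).tendsto 0
      exact this.eventually (eventually_lt_nhds Real.pi_pos)
    have hright : HasDerivWithinAt (fun θ : ℝ => V (p * Complex.exp (θ * Complex.I))) 0
        (Ici 0) 0 := by
      refine (harc p hp0).congr_of_eventuallyEq ?_ ?_
      · filter_upwards [self_mem_nhdsWithin, nhdsWithin_le_nhds hpi] with θ h1 h2
        rcases (mem_Ici.1 h1).eq_or_lt with h | h
        · subst h
          simp [hV, hray p hp0]
        · have : 0 < ((p : ℂ) * Complex.exp (θ * Complex.I)).im := by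
            rw [him]
            exact mul_pos hp0 (Real.sin_pos_of_pos_of_lt_pi h (abs_lt.1 h2).2)
          simp only [hV, if_pos this]
      · simp [hV, hray p hp0]
    have hleft : HasDerivWithinAt (fun θ : ℝ => V (p * Complex.exp (θ * Complex.I))) 0
        (Iic 0) 0 := by
      refine (hasDerivWithinAt_const (0 : ℝ) (Iic (0 : ℝ)) (0 : ℂ)).congr_of_eventuallyEq ?_ ?_
      · filter_upwards [self_mem_nhdsWithin, nhdsWithin_le_nhds hpi] with θ h1 h2
        have : ¬ 0 < ((p : ℂ) * Complex.exp (θ * Complex.I)).im := by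
          rw [him, not_lt]
          exact mul_nonpos_of_nonneg_of_nonpos hp0.le
            (Real.sin_nonpos_of_nonpos_of_neg_pi_le h1 (abs_lt.1 h2).1.le)
        simp only [hV, if_neg this]
      · simp [hV]
    have := hleft.union hright
    rw [Iic_union_Ici, hasDerivWithinAt_univ] at this
    exact ⟨hp0, this.differentiableAt⟩
  have hVzero : ∀ z ∈ ball c (ρ / 2), z ≠ c → V z = 0 := by
    intro z hz hzc
    have hle : dist z c ≤ ρ / 2 := (mem_ball.1 hz).le
    have hsub' := (closedBall_subset_closedBall (x := c) hle)
    refine eq_zero_of_harmonic_above_real (c := c) (R := dist z c) (dist_pos.2 hzc) ?_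
      (hVcont.mono hsub') ?_ ?_ ?_ z rfl
    · simpa [hc] using hρ
    · intro y hy
      simp only [hV, if_neg (not_lt.2 hy)]
    · intro y hy him
      have hev : V =ᶠ[𝓝 y] v := by
        filter_upwards [(Complex.continuous_im.tendsto y).eventually (eventually_gt_nhds him)]
          with x hx
        simp only [hV, if_pos hx]
      exact (harmonicAt_congr_nhds hev).2
        (hharm y (hmem y (hsub (hsub' (ball_subset_closedBall hy))) him))
    · intro p hp
      exact hVarc p (hsub (hsub' (ball_subset_closedBall hp)))
  set q : ℂ := 1 + (ρ / 8 : ℝ) * Complex.I with hq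
  have hqim : 0 < q.im := by simpa [hq] using hρ
  have hqball : q ∈ ball c (ρ / 2) := by
    have : q - c = (3 * ρ / 8 : ℝ) * Complex.I := by
      rw [hq, hc]; push_cast; ring
    rw [mem_ball, dist_eq_norm, this, norm_mul, Complex.norm_I, mul_one, Complex.norm_real,
      Real.norm_of_nonneg (by linarith)]
    linarith
  have hev : ∀ᶠ z in 𝓝 q, v z = 0 := by
    filter_upwards [isOpen_ball.mem_nhds hqball,
      (Complex.continuous_im.tendsto q).eventually (eventually_gt_nhds hqim)] with z hz him
    have hzc : z ≠ c := by
      rintro rfl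
      simp [hc] at him
      linarith
    simpa only [hV, if_pos him] using hVzero z hz hzc
  have hqC : q ∈ CSec θ₀ := hmem q (hsub (ball_subset_closedBall hqball)) hqim
  have hL : ∀ L : ℂ →L[ℝ] ℝ, ∀ z ∈ CSec θ₀, L (v z) = 0 := by
    intro L
    refine AnalyticOnNhd.eqOn_zero_of_preconnected_of_eventuallyEq_zero (𝕜 := ℝ) (z₀ := q)
      (fun z hz => HarmonicAt.analyticAt ((hharm z hz).comp_CLM L)) (isPreconnected_CSec θ₀) hqC ?_
    filter_upwards [hev] with z hz
    simp [hz]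
  intro z hz
  exact Complex.ext (hL Complex.reCLM z hz) (hL Complex.imCLM z hz)

end Auxiliary

/-- Lemma 3.3: if `θ₀ ∉ πℚ` and `w` is harmonic in the sector of
angle `θ₀`, vanishes on both boundary rays and satisfies the Bernoulli conditions
`∂_θ w = c₀ ∂_θ H` on both rays, where `H = a z^m + b z̄^m` is a harmonic homogeneous
polynomial of degree `m ≥ 1`, then `a = b = 0`, hence `w ≡ 0` and `H ≡ 0`. -/
theorem sector_rigidity
    (θ₀ : ℝ) (hθ₀ : θ₀ ∈ Ioo (0 : ℝ) (2 * Real.pi))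
    (hirr : ¬ ∃ q : ℚ, θ₀ = (q : ℝ) * Real.pi)
    (m : ℕ) (hm : 1 ≤ m) (c₀ : ℝ) (hc₀ : c₀ ≠ 0) (a b : ℂ)
    (H : ℂ → ℂ) (hH : ∀ z : ℂ, H z = a * z ^ m + b * (starRingEnd ℂ z) ^ m)
    (w : ℂ → ℂ)
    -- w harmonic in the sector
    (hw2 : ContDiffOn ℝ 2 w (CSec θ₀))
    (hharm : ∀ z ∈ CSec θ₀, lapC w z = 0)
    (hcont : ContinuousOn w (closure (CSec θ₀)))
    -- Dirichlet conditions on the two rays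
    (hd0 : ∀ r : ℝ, 0 ≤ r → w (r : ℂ) = 0)
    (hdθ : ∀ r : ℝ, 0 ≤ r → w ((r : ℂ) * Complex.exp (θ₀ * Complex.I)) = 0)
    -- Bernoulli conditions on the two rays
    (hb0 : ∀ r : ℝ, 0 < r →
      HasDerivWithinAt (fun θ : ℝ => w ((r : ℂ) * Complex.exp (θ * Complex.I)))
        ((c₀ : ℂ) * deriv (fun θ : ℝ => H ((r : ℂ) * Complex.exp (θ * Complex.I))) 0)
        (Ici 0) 0)
    (hbθ : ∀ r : ℝ, 0 < r →
      HasDerivWithinAt (fun θ : ℝ => w ((r : ℂ) * Complex.exp (θ * Complex.I)))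
        ((c₀ : ℂ) * deriv (fun θ : ℝ => H ((r : ℂ) * Complex.exp (θ * Complex.I))) θ₀)
        (Iic θ₀) θ₀) :
    a = 0 ∧ b = 0 ∧ (∀ z ∈ closure (CSec θ₀), w z = 0) ∧ (∀ z : ℂ, H z = 0) := by
  have hθpos : 0 < θ₀ := hθ₀.1
  have hmR : (m : ℝ) ≠ 0 := by exact_mod_cast (by omega : m ≠ 0)
  have hsin : Real.sin (m * θ₀) ≠ 0 := by
    intro h
    obtain ⟨n, hn⟩ := Real.sin_eq_zero_iff.1 h
    refine hirr ⟨n / m, ?_⟩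
    push_cast
    field_simp
    linarith
  have hexp : Complex.exp (m * θ₀ * Complex.I) - Complex.exp (-(m * θ₀ * Complex.I)) ≠ 0 := by
    intro h
    apply hsin
    have h2 := Complex.two_sin ((m : ℂ) * θ₀)
    rw [neg_mul, ← neg_sub, h, neg_zero, zero_mul] at h2
    have h3 : Complex.sin ((m : ℂ) * θ₀) = 0 := by simpa using h2
    exact_mod_cast h3
  have hH' : H = fun z => a * z ^ m + b * (starRingEnd ℂ z) ^ m := funext hH
  subst hH'
  set k : ℂ := c₀ * (a - b) / 2 with hk
  set Q : ℂ → ℂ := fun z => k * z ^ m + -k * (starRingEnd ℂ z) ^ m with hQ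
  have hQharm : ∀ z, InnerProductSpace.HarmonicAt Q z := by
    intro z
    have hp : AnalyticAt ℂ (fun z : ℂ => z ^ m) z := by fun_prop
    have h1 := hp.harmonicAt.comp_CLM ((ContinuousLinearMap.mul ℂ ℂ k).restrictScalars ℝ)
    have h2 := hp.harmonicAt_conj.comp_CLM ((ContinuousLinearMap.mul ℂ ℂ (-k)).restrictScalars ℝ)
    refine (InnerProductSpace.harmonicAt_congr_nhds (Filter.Eventually.of_forall fun y => ?_)).2 (h1.add h2)
    simp [hQ]
  have hQcont : Continuous Q := continuous_iff_continuousAt.2 fun z => (hQharm z).1.continuousAt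
  have hwharm : ∀ z ∈ CSec θ₀, InnerProductSpace.HarmonicAt w z := by
    intro z hz
    have hcd : ∀ y ∈ CSec θ₀, ContDiffAt ℝ 2 w y := fun y hy =>
      hw2.contDiffAt ((isOpen_CSec θ₀).mem_nhds hy)
    refine ⟨hcd z hz, ?_⟩
    filter_upwards [(isOpen_CSec θ₀).mem_nhds hz] with y hy
    rw [← lapC_eq_laplacian (hcd y hy), hharm y hy]
    rfl
  have hQray : ∀ r : ℝ, Q r = 0 := fun r => by simp [hQ]
  have hv : ∀ z ∈ CSec θ₀, w z - Q z = 0 := by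
    refine eq_zero_of_cauchy_data hθpos (v := fun z => w z - Q z)
      (hcont.sub hQcont.continuousOn) (fun z hz => (hwharm z hz).sub (hQharm z)) ?_ ?_
    · intro r hr
      rw [hd0 r hr.le, hQray, sub_zero]
    · intro r hr
      have h1 := (hb0 r hr).sub
        (hasDerivAt_harmonic_polynomial_arc k (-k) m r 0).hasDerivWithinAt (s := Ici 0)
      convert! h1 using 1
      rw [(hasDerivAt_harmonic_polynomial_arc a b m r 0).deriv, hk]
      simp
      ring
  have hwQ : ∀ z ∈ closure (CSec θ₀), w z = Q z := by
    have : EqOn w Q (CSec θ₀) := fun z hz => sub_eq_zero.1 (hv z hz)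
    exact this.of_subset_closure hcont hQcont.continuousOn subset_closure subset_rfl
  have hab : a = b := by
    have hmem : Complex.exp (θ₀ * Complex.I) ∈ closure (CSec θ₀) :=
      exp_mem_closure_CSec hθpos (by simpa using hθpos.le)
    have h1 := hwQ _ hmem
    have h2 := hdθ 1 zero_le_one
    rw [Complex.ofReal_one, one_mul, h1] at h2
    have h3 : Q (Complex.exp (θ₀ * Complex.I)) = k * (Complex.exp (m * θ₀ * Complex.I) -
        Complex.exp (-(m * θ₀ * Complex.I))) := by
      simp only [hQ]
      rw [← Complex.exp_conj, ← Complex.exp_nat_mul, ← Complex.exp_nat_mul]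
      simp only [map_mul, Complex.conj_ofReal, Complex.conj_I]
      ring_nf
    rw [h3] at h2
    have h4 : k = 0 := (mul_eq_zero.1 h2).resolve_right hexp
    have hc : (c₀ : ℂ) ≠ 0 := by exact_mod_cast hc₀
    have h5 : a - b = 0 := by
      simpa [hk, hc] using h4
    exact sub_eq_zero.1 h5
  subst hab
  have hQ0 : ∀ z, Q z = 0 := fun z => by simp [hQ, hk]
  have hw0 : ∀ z ∈ closure (CSec θ₀), w z = 0 := fun z hz => (hwQ z hz).trans (hQ0 z)
  have ha : a = 0 := by
    have h1 := hbθ 1 one_pos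
    have h2 : HasDerivWithinAt
        (fun θ : ℝ => w (((1 : ℝ) : ℂ) * Complex.exp (θ * Complex.I))) 0 (Iic θ₀) θ₀ := by
      have hz : ∀ θ : ℝ, 0 ≤ θ → θ ≤ θ₀ →
          w (((1 : ℝ) : ℂ) * Complex.exp (θ * Complex.I)) = 0 := fun θ h0 h1 => by
        rw [Complex.ofReal_one, one_mul]
        exact hw0 _ (exp_mem_closure_CSec hθpos (by simpa using ⟨h0, h1⟩))
      refine (hasDerivWithinAt_const θ₀ (Iic θ₀) (0 : ℂ)).congr_of_eventuallyEq ?_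
        (hz θ₀ hθpos.le le_rfl)
      filter_upwards [self_mem_nhdsWithin, nhdsWithin_le_nhds (eventually_gt_nhds hθpos)]
        with θ h1 h2 using hz θ h2.le h1
    have h3 := (uniqueDiffOn_Iic θ₀ θ₀ self_mem_Iic).eq_deriv _ h1 h2
    rw [(hasDerivAt_harmonic_polynomial_arc a a m 1 θ₀).deriv, ← mul_sub] at h3
    have hmC : (m : ℂ) ≠ 0 := by exact_mod_cast (by omega : m ≠ 0)
    simpa [hc₀, hexp, hmC] using h3
  refine ⟨ha, ha, hw0, fun z => ?_⟩
  simp [ha]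

end
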